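/- arXiv:1807.01071 — 2 statements merged into one kernel-verified Lean document; each statement's English description precedes it below -/
import Mathlib

section
/- Fix positive reals d (antenna spacing), λw (wavelength), γ, and a real c > 1. For each M ≥ 1, let θ_k(M) and θ_ℓ(M) be real angles with sin(θ_ℓ(M)) − sin(θ_k(M)) = γ/M^c, and let h̄_k(M) = h̄_M(θ_k(M)) and h̄_ℓ(M) = h̄_M(θ_ℓ(M)) be the corresponding ULA steering vectors in ℂ^M. Then lim_{M→∞} (1/M²)·|h̄_ℓ(M)^H h̄_k(M)|² = 1. -/
open Finset Filter Real

/-- The ULA steering vector in `ℂ^M` for angle `θ`, antenna spacing `d` and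
wavelength `lw`: its `m`-th entry is `exp(−i·(2πd/lw)·m·sin θ)` for `m = 0, …, M−1`. -/
noncomputable def steering (d lw : ℝ) (M : ℕ) (θ : ℝ) : Fin M → ℂ :=
  fun m => Complex.exp (-Complex.I * (2 * π * d / lw) * (m : ℕ) * Real.sin θ)

/-- The summands of the inner product of two steering vectors depend only on the difference of
the sines of the two angles. -/
theorem star_steering_mul_steering (d lw : ℝ) (M : ℕ) (θ φ : ℝ) (m : Fin M) :
    star (steering d lw M θ m) * steering d lw M φ m =
      Complex.exp (Complex.I *
        ((2 * π * d / lw * (m : ℕ) * (Real.sin θ - Real.sin φ) : ℝ) : ℂ)) := by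
  simp only [steering, Complex.star_def]
  rw [← Complex.exp_conj, ← Complex.exp_add]
  congr 1
  simp only [map_mul, map_neg, map_div₀, Complex.conj_I, Complex.conj_ofReal, map_natCast,
    map_ofNat]
  push_cast
  ring

/-- The inner product of two steering vectors differs from `M` by at most
`M² · (2π|d|/|lw|) · |sin θ − sin φ|`. -/
theorem norm_sum_star_steering_mul_steering_sub_le (d lw : ℝ) (M : ℕ) (θ φ : ℝ) :
    ‖∑ m : Fin M, star (steering d lw M θ m) * steering d lw M φ m - M‖ ≤
      M * (|2 * π * d / lw| * M * |Real.sin θ - Real.sin φ|) := by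
  have hsum : ∑ m : Fin M, star (steering d lw M θ m) * steering d lw M φ m - M =
      ∑ m : Fin M, (star (steering d lw M θ m) * steering d lw M φ m - 1) := by
    simp [Finset.sum_sub_distrib]
  rw [hsum]
  refine (norm_sum_le_of_le (f := fun m : Fin M =>
    star (steering d lw M θ m) * steering d lw M φ m - 1) Finset.univ
    (n := fun _ => |2 * π * d / lw| * M * |Real.sin θ - Real.sin φ|) fun m _ => ?_).trans_eq
    (by simp)
  rw [star_steering_mul_steering]
  refine Real.norm_exp_I_mul_ofReal_sub_one_le.trans ?_
  rw [Real.norm_eq_abs, abs_mul, abs_mul, Nat.abs_cast]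
  gcongr
  exact m.isLt.le

/-- Fix positive reals `d` (antenna spacing), `lw` (wavelength), `γ`,
and a real `c > 1`.  For each `M ≥ 1`, let `θk M` and `θl M` be real angles with
`sin (θl M) − sin (θk M) = γ/M^c`, and let `h̄k M` and `h̄l M` be the corresponding
ULA steering vectors in `ℂ^M`.  Then
`lim_{M→∞} (1/M²)·|h̄l Mᴴ h̄k M|² = 1`. -/
theorem stmt11 (d lw γ c : ℝ) (hd : 0 < d) (hlw : 0 < lw) (hγ : 0 < γ) (hc : 1 < c)
    (θk θl : ℕ → ℝ)
    (hangle : ∀ M : ℕ, 1 ≤ M → Real.sin (θl M) - Real.sin (θk M) = γ / (M : ℝ) ^ c) :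
    Tendsto
      (fun M : ℕ => (1 / (M : ℝ) ^ 2) *
        ‖∑ m : Fin M, star (steering d lw M (θl M) m) * steering d lw M (θk M) m‖ ^ 2)
      atTop (nhds 1) := by
  have hsum : Tendsto
      (fun M : ℕ => (∑ m : Fin M,
        star (steering d lw M (θl M) m) * steering d lw M (θk M) m) / (M : ℂ))
      atTop (nhds 1) := by
    rw [tendsto_iff_norm_sub_tendsto_zero]
    have hbound : Tendsto (fun M : ℕ => |2 * π * d / lw| * γ * (M : ℝ) ^ (-(c - 1)))
        atTop (nhds 0) := by
      simpa using ((tendsto_rpow_neg_atTop (sub_pos.mpr hc)).comp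
        tendsto_natCast_atTop_atTop).const_mul (|2 * π * d / lw| * γ)
    refine squeeze_zero' (Eventually.of_forall fun M => norm_nonneg _) ?_ hbound
    filter_upwards [eventually_ge_atTop 1] with M hM
    have hMpos : (0 : ℝ) < M := by exact_mod_cast hM
    have hM0 : (M : ℂ) ≠ 0 := by exact_mod_cast hMpos.ne'
    have hpow : (M : ℝ) ^ (-(c - 1)) = M / (M : ℝ) ^ c := by
      rw [neg_sub, Real.rpow_sub hMpos, Real.rpow_one]
    rw [div_sub_one hM0, norm_div, Complex.norm_natCast, div_le_iff₀ hMpos, hpow]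
    refine (norm_sum_star_steering_mul_steering_sub_le d lw M (θl M) (θk M)).trans_eq ?_
    rw [hangle M hM, abs_of_pos (div_pos hγ (Real.rpow_pos_of_pos hMpos c))]
    ring
  have hsq := hsum.norm.pow 2
  simp only [norm_one, one_pow] at hsq
  refine hsq.congr fun M => ?_
  rw [norm_div, Complex.norm_natCast, div_pow]
  ring
end

section
/- Under the same setup as the mean interference power formula — K_k, K_ℓ ≥ 0; deterministic h̄_k, h̄_ℓ ∈ ℂ^M; Hermitian positive semidefinite R_k, R_ℓ with Hermitian positive semidefinite square roots; independent random vectors z_k, z_ℓ with zero mean and identity covariance (E[(z)_i · conj((z)_j)] = δ_{ij}); and g_k, g_ℓ defined by g = √(K/(K+1))·h̄ + √(1/(K+1))·R^{1/2} z — the complex random variable T = g_k^H g_ℓ satisfies E[T] = √(K_k/(K_k+1))·√(K_ℓ/(K_ℓ+1))·(h̄_k^H h̄_ℓ), and E[|T − E[T]|²] = (K_ℓ/(K_ℓ+1))·(1/(K_k+1))·(h̄_ℓ^H R_k h̄_ℓ) + tr(R_ℓ R_k)/((K_k+1)(K_ℓ+1)) + (K_k/(K_k+1))·(1/(K_ℓ+1))·(h̄_k^H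 R_ℓ h̄_k). -/
open Matrix Finset MeasureTheory ProbabilityTheory
open scoped ComplexOrder

/-- The Ricean channel vector `g = √(K/(K+1))·h̄ + √(1/(K+1))·R^{1/2} z`, where
`S = R^{1/2}` is the positive semidefinite square root of the covariance matrix. -/
noncomputable def ricean {M : ℕ} (K : ℝ) (hbar : Fin M → ℂ)
    (S : Matrix (Fin M) (Fin M) ℂ) (zv : Fin M → ℂ) : Fin M → ℂ :=
  fun i => (Real.sqrt (K / (K + 1)) : ℂ) * hbar i +
    (Real.sqrt (1 / (K + 1)) : ℂ) * (S *ᵥ zv) i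

/-- The mean of the Hermitian product of two independent random vectors is the Hermitian product
of their means. -/
theorem hasMean_star_dotProduct {Ω ι : Type*} [MeasurableSpace Ω] [Fintype ι] {P : Measure Ω}
    {u v : Ω → ι → ℂ} (huv : IndepFun u v P)
    (hu : ∀ i, Integrable (fun ω => u ω i) P) (hv : ∀ i, Integrable (fun ω => v ω i) P) :
    Integrable (fun ω => ∑ i, star (u ω i) * v ω i) P ∧
      ∫ ω, (∑ i, star (u ω i) * v ω i) ∂P
        = ∑ i, star (∫ ω, u ω i ∂P) * ∫ ω, v ω i ∂P := by
  have hstar : ∀ i, Integrable (fun ω => star (u ω i)) P := fun i =>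
    (LinearIsometryEquiv.integrable_comp_iff (Complex.conjLIE)).2 (hu i)
  have hind : ∀ i, IndepFun (fun ω => star (u ω i)) (fun ω => v ω i) P := fun i =>
    huv.comp (φ := fun x : ι → ℂ => star (x i)) (ψ := fun x : ι → ℂ => x i)
      (by fun_prop) (by fun_prop)
  have hmul : ∀ i, Integrable (fun ω => star (u ω i) * v ω i) P := fun i =>
    (hind i).integrable_mul (hstar i) (hv i)
  refine ⟨integrable_finsetSum _ fun i _ => hmul i, ?_⟩
  rw [integral_finsetSum _ fun i _ => hmul i]
  refine Finset.sum_congr rfl fun i _ => ?_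
  rw [(hind i).integral_fun_mul_eq_mul_integral (hstar i).aestronglyMeasurable
    (hv i).aestronglyMeasurable]
  congr 1
  exact integral_conj

/-- The second moment of the Hermitian product of two independent random vectors, in terms of
their second-moment matrices. -/
theorem secondMoment_star_dotProduct {Ω ι : Type*} [MeasurableSpace Ω] [Fintype ι]
    {P : Measure Ω} {u v : Ω → ι → ℂ} (huv : IndepFun u v P)
    (hu : ∀ i j, Integrable (fun ω => u ω i * star (u ω j)) P)
    (hv : ∀ i j, Integrable (fun ω => v ω i * star (v ω j)) P) :
    Integrable (fun ω => (∑ i, star (u ω i) * v ω i) * star (∑ i, star (u ω i) * v ω i)) P ∧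
      ∫ ω, (∑ i, star (u ω i) * v ω i) * star (∑ i, star (u ω i) * v ω i) ∂P
        = ∑ i, ∑ j, (∫ ω, u ω j * star (u ω i) ∂P) * ∫ ω, v ω i * star (v ω j) ∂P := by
  have hind : ∀ i j, IndepFun (fun ω => u ω j * star (u ω i)) (fun ω => v ω i * star (v ω j)) P :=
    fun i j => huv.comp (φ := fun x : ι → ℂ => x j * star (x i))
      (ψ := fun x : ι → ℂ => x i * star (x j)) (by fun_prop) (by fun_prop)
  have hmul : ∀ i j,
      Integrable (fun ω => (u ω j * star (u ω i)) * (v ω i * star (v ω j))) P := fun i j =>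
    (hind i j).integrable_mul (hu j i) (hv i j)
  have hexp : (fun ω => (∑ i, star (u ω i) * v ω i) * star (∑ i, star (u ω i) * v ω i))
      = fun ω => ∑ i, ∑ j, (u ω j * star (u ω i)) * (v ω i * star (v ω j)) := by
    funext ω
    rw [star_sum, Finset.sum_mul_sum]
    refine Finset.sum_congr rfl fun i _ => Finset.sum_congr rfl fun j _ => ?_
    rw [star_mul', star_star]
    ring
  rw [hexp]
  refine ⟨integrable_finsetSum _ fun i _ => integrable_finsetSum _ fun j _ => hmul i j, ?_⟩
  rw [integral_finsetSum _ fun i _ => integrable_finsetSum _ fun j _ => hmul i j]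
  refine Finset.sum_congr rfl fun i _ => ?_
  rw [integral_finsetSum _ fun j _ => hmul i j]
  refine Finset.sum_congr rfl fun j _ => ?_
  exact (hind i j).integral_fun_mul_eq_mul_integral (hu j i).aestronglyMeasurable
    (hv i j).aestronglyMeasurable

/-- The variance of a complex random variable is its second moment minus the squared mean. -/
theorem integral_norm_sub_integral_sq {Ω : Type*} [MeasurableSpace Ω] {P : Measure Ω}
    [IsProbabilityMeasure P] {T : Ω → ℂ} (hT : Integrable T P)
    (hT2 : Integrable (fun ω => T ω * star (T ω)) P) :
    ∫ ω, ‖T ω - ∫ ω', T ω' ∂P‖ ^ 2 ∂P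
      = (∫ ω, T ω * star (T ω) ∂P - (∫ ω, T ω ∂P) * star (∫ ω, T ω ∂P)).re := by
  set c := ∫ ω, T ω ∂P with hc
  have hstar : Integrable (fun ω => star (T ω)) P :=
    (LinearIsometryEquiv.integrable_comp_iff (Complex.conjLIE)).2 hT
  have hstarint : ∫ ω, star (T ω) ∂P = star c := integral_conj
  have hpt : ∀ ω, ((‖T ω - c‖ ^ 2 : ℝ) : ℂ)
      = T ω * star (T ω) - star c * T ω - c * star (T ω) + c * star c := by
    intro ω
    have h := Complex.mul_conj' (T ω - c)
    push_cast
    rw [← h, map_sub]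
    simp only [Complex.star_def]
    ring
  have key : ((∫ ω, ‖T ω - c‖ ^ 2 ∂P : ℝ) : ℂ) = ∫ ω, T ω * star (T ω) ∂P - c * star c := by
    rw [← integral_complex_ofReal]
    simp_rw [hpt]
    have h1 : Integrable (fun ω => T ω * star (T ω) - star c * T ω) P := hT2.sub (hT.const_mul _)
    have h2 : Integrable (fun ω => T ω * star (T ω) - star c * T ω - c * star (T ω)) P :=
      h1.sub (hstar.const_mul _)
    rw [integral_add h2 (integrable_const _), integral_sub h1 (hstar.const_mul _),
      integral_sub hT2 (hT.const_mul _), integral_const_mul, integral_const_mul, hstarint, ← hc]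
    simp only [integral_const, probReal_univ, one_smul]
    ring
  rw [← key, Complex.ofReal_re]

/-- The Ricean channel vector has mean `√(K/(K+1))·h̄` and second-moment matrix
`(K/(K+1))·h̄h̄ᴴ + (1/(K+1))·R`. -/
theorem ricean_moments {Ω : Type*} [MeasurableSpace Ω] {P : Measure Ω} [IsProbabilityMeasure P]
    {M : ℕ} {K : ℝ} (hK : 0 ≤ K) (h : Fin M → ℂ) {R S : Matrix (Fin M) (Fin M) ℂ}
    (hS : S.IsHermitian) (hSR : S * S = R) {z : Ω → Fin M → ℂ}
    (hint1 : ∀ i, Integrable (fun ω => z ω i) P)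
    (hint2 : ∀ i j, Integrable (fun ω => z ω i * star (z ω j)) P)
    (hmean : ∀ i, ∫ ω, z ω i ∂P = 0)
    (hcov : ∀ i j, ∫ ω, z ω i * star (z ω j) ∂P = if i = j then 1 else 0) :
    (∀ i, Integrable (fun ω => ricean K h S (z ω) i) P) ∧
    (∀ i j, Integrable (fun ω => ricean K h S (z ω) i * star (ricean K h S (z ω) j)) P) ∧
    (∀ i, ∫ ω, ricean K h S (z ω) i ∂P = (Real.sqrt (K / (K + 1)) : ℂ) * h i) ∧
    ∀ i j, ∫ ω, ricean K h S (z ω) i * star (ricean K h S (z ω) j) ∂P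
      = (Real.sqrt (K / (K + 1)) * h i) * star (Real.sqrt (K / (K + 1)) * h j)
        + ((1 / (K + 1) : ℝ) : ℂ) * R i j := by
  have hbb : (Real.sqrt (1 / (K + 1)) : ℂ) * Real.sqrt (1 / (K + 1)) = ((1 / (K + 1) : ℝ) : ℂ) := by
    rw [← Complex.ofReal_mul, Real.mul_self_sqrt (by positivity)]
  have hbstar : star (Real.sqrt (1 / (K + 1)) : ℂ) = Real.sqrt (1 / (K + 1)) :=
    Complex.conj_ofReal _
  unfold ricean
  set b : ℂ := (Real.sqrt (1 / (K + 1)) : ℂ)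
  set a : ℂ := (Real.sqrt (K / (K + 1)) : ℂ)
  have hw : ∀ i, Integrable (fun ω => (S *ᵥ z ω) i) P := by
    intro i
    simp only [mulVec, dotProduct]
    exact integrable_finsetSum _ fun j _ => (hint1 j).const_mul _
  have hw0 : ∀ i, ∫ ω, (S *ᵥ z ω) i ∂P = 0 := by
    intro i
    simp only [mulVec, dotProduct]
    rw [integral_finsetSum _ fun j _ => (hint1 j).const_mul _]
    simp [integral_const_mul, hmean]
  have hwstar : ∀ i, Integrable (fun ω => star ((S *ᵥ z ω) i)) P := fun i =>
    (LinearIsometryEquiv.integrable_comp_iff (Complex.conjLIE)).2 (hw i)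
  have hwstar0 : ∀ i, ∫ ω, star ((S *ᵥ z ω) i) ∂P = 0 := fun i =>
    integral_conj.trans (by rw [hw0, map_zero])
  have hexp : ∀ i j, (fun ω => (S *ᵥ z ω) i * star ((S *ᵥ z ω) j))
      = fun ω => ∑ p, ∑ q, (S i p * star (S j q)) * (z ω p * star (z ω q)) := by
    intro i j
    funext ω
    simp only [mulVec, dotProduct]
    rw [star_sum, Finset.sum_mul_sum]
    refine Finset.sum_congr rfl fun p _ => Finset.sum_congr rfl fun q _ => ?_
    rw [star_mul']
    ring
  have hww : ∀ i j, Integrable (fun ω => (S *ᵥ z ω) i * star ((S *ᵥ z ω) j)) P := by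
    intro i j
    rw [hexp]
    exact integrable_finsetSum _ fun p _ => integrable_finsetSum _ fun q _ =>
      (hint2 p q).const_mul _
  have hwwR : ∀ i j, ∫ ω, (S *ᵥ z ω) i * star ((S *ᵥ z ω) j) ∂P = R i j := by
    intro i j
    rw [hexp, integral_finsetSum _ fun p _ => integrable_finsetSum _ fun q _ =>
      (hint2 p q).const_mul _, ← hSR, mul_apply]
    refine Finset.sum_congr rfl fun p _ => ?_
    rw [integral_finsetSum _ fun q _ => (hint2 p q).const_mul _]
    simp only [integral_const_mul, hcov]
    simp
    left
    exact hS.apply p j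
  have hpt : ∀ i j, (fun ω => (a * h i + b * (S *ᵥ z ω) i) * star (a * h j + b * (S *ᵥ z ω) j))
      = fun ω => (a * h i) * star (a * h j) + (a * h i * b) * star ((S *ᵥ z ω) j)
        + (b * star (a * h j)) * (S *ᵥ z ω) i
        + (b * b) * ((S *ᵥ z ω) i * star ((S *ᵥ z ω) j)) := by
    intro i j
    funext ω
    rw [star_add, star_mul' b, hbstar]
    ring
  have h1 : ∀ i j, Integrable (fun ω => (a * h i) * star (a * h j)
      + (a * h i * b) * star ((S *ᵥ z ω) j)) P := fun i j =>
    (integrable_const _).add ((hwstar j).const_mul _)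
  have h2 : ∀ i j, Integrable (fun ω => (a * h i) * star (a * h j)
      + (a * h i * b) * star ((S *ᵥ z ω) j) + (b * star (a * h j)) * (S *ᵥ z ω) i) P :=
    fun i j => (h1 i j).add ((hw i).const_mul _)
  refine ⟨fun i => (integrable_const _).add ((hw i).const_mul _), fun i j => ?_, fun i => ?_,
    fun i j => ?_⟩
  · rw [hpt]
    exact (h2 i j).add ((hww i j).const_mul _)
  · rw [integral_add (integrable_const _) ((hw i).const_mul _), integral_const_mul b, hw0]
    simp
  · rw [hpt, integral_add (h2 i j) ((hww i j).const_mul _),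
      integral_add (h1 i j) ((hw i).const_mul _),
      integral_add (integrable_const _) ((hwstar j).const_mul _)]
    simp only [integral_const_mul, hw0, hwstar0, hwwR, hbb]
    simp

/-- Expansion of `tr((mmᴴ + βA)(nnᴴ + γB)) - |mᴴn|²`. -/
theorem sum_secondMoment_sub_normSq {ι : Type*} [Fintype ι] (m n : ι → ℂ) (A B : Matrix ι ι ℂ)
    (β γ : ℂ) :
    ∑ i, ∑ j, (m j * star (m i) + β * A j i) * (n i * star (n j) + γ * B i j)
        - (∑ i, star (m i) * n i) * star (∑ i, star (m i) * n i)
      = β * (∑ i, ∑ j, star (n i) * A i j * n j) + β * γ * (B * A).trace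
        + γ * ∑ i, ∑ j, star (m i) * B i j * m j := by
  have hA : ∑ i, ∑ j, star (n i) * A i j * n j = ∑ i, ∑ j, star (n j) * A j i * n i :=
    Finset.sum_comm
  rw [hA, star_sum, Finset.sum_mul_sum]
  simp only [trace, diag_apply, mul_apply, Finset.mul_sum, ← Finset.sum_add_distrib,
    ← Finset.sum_sub_distrib]
  refine Finset.sum_congr rfl fun i _ => Finset.sum_congr rfl fun j _ => ?_
  rw [star_mul', star_star]
  ring

theorem measurable_ricean {M : ℕ} (K : ℝ) (h : Fin M → ℂ) (S : Matrix (Fin M) (Fin M) ℂ) :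
    Measurable (ricean K h S) := by
  unfold ricean
  simp only [mulVec, dotProduct]
  fun_prop

theorem sum_star_smul_mul_mul {ι : Type*} [Fintype ι] {x : ℝ} (hx : 0 ≤ x) (n : ι → ℂ)
    (A : Matrix ι ι ℂ) :
    ∑ i, ∑ j, star ((Real.sqrt x : ℂ) * n i) * A i j * ((Real.sqrt x : ℂ) * n j)
      = (x : ℂ) * ∑ i, ∑ j, star (n i) * A i j * n j := by
  have hstar : star (Real.sqrt x : ℂ) = Real.sqrt x := Complex.conj_ofReal _
  have hsq : (x : ℂ) = Real.sqrt x * Real.sqrt x := by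
    rw [← Complex.ofReal_mul, Real.mul_self_sqrt hx]
  rw [hsq]
  simp only [Finset.mul_sum]
  refine Finset.sum_congr rfl fun i _ => Finset.sum_congr rfl fun j _ => ?_
  rw [star_mul', hstar]
  ring

/-- for the Ricean channels `g_k`, `g_ℓ` (with independent, zero-mean,
identity-covariance diffuse components), the complex random variable `T = g_kᴴ g_ℓ`
satisfies `E[T] = √(Kk/(Kk+1))·√(Kℓ/(Kℓ+1))·(h̄kᴴ h̄ℓ)` and
`E[|T − E[T]|²] = (Kℓ/(Kℓ+1))·(1/(Kk+1))·(h̄ℓᴴ Rk h̄ℓ) + tr(Rℓ Rk)/((Kk+1)(Kℓ+1))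
  + (Kk/(Kk+1))·(1/(Kℓ+1))·(h̄kᴴ Rℓ h̄k)`. -/
theorem stmt16 {Ω : Type*} [MeasurableSpace Ω] (P : Measure Ω) [IsProbabilityMeasure P]
    {M : ℕ} (Kk Kl : ℝ) (hKk : 0 ≤ Kk) (hKl : 0 ≤ Kl)
    (hbk hbl : Fin M → ℂ)
    (Rk Rl Sk Sl : Matrix (Fin M) (Fin M) ℂ)
    (hRk : Rk.PosSemidef) (hRl : Rl.PosSemidef)
    (hSk : Sk.PosSemidef) (hSl : Sl.PosSemidef)
    (hSk2 : Sk * Sk = Rk) (hSl2 : Sl * Sl = Rl)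
    (zk zl : Ω → Fin M → ℂ)
    (hindep : IndepFun zk zl P)
    (hzkint1 : ∀ i, Integrable (fun ω => zk ω i) P)
    (hzkint2 : ∀ i j, Integrable (fun ω => zk ω i * star (zk ω j)) P)
    (hzlint1 : ∀ i, Integrable (fun ω => zl ω i) P)
    (hzlint2 : ∀ i j, Integrable (fun ω => zl ω i * star (zl ω j)) P)
    (hzkmean : ∀ i, ∫ ω, zk ω i ∂P = 0)
    (hzkcov : ∀ i j, ∫ ω, zk ω i * star (zk ω j) ∂P = if i = j then 1 else 0)
    (hzlmean : ∀ i, ∫ ω, zl ω i ∂P = 0)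
    (hzlcov : ∀ i j, ∫ ω, zl ω i * star (zl ω j) ∂P = if i = j then 1 else 0) :
    (∫ ω, (∑ i, star (ricean Kk hbk Sk (zk ω) i) * ricean Kl hbl Sl (zl ω) i) ∂P
        = ((Real.sqrt (Kk / (Kk + 1)) * Real.sqrt (Kl / (Kl + 1)) : ℝ) : ℂ) *
            ∑ i, star (hbk i) * hbl i) ∧
      (∫ ω, ‖(∑ i, star (ricean Kk hbk Sk (zk ω) i) * ricean Kl hbl Sl (zl ω) i) -
            ∫ ω', (∑ i, star (ricean Kk hbk Sk (zk ω') i) *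
              ricean Kl hbl Sl (zl ω') i) ∂P‖ ^ 2 ∂P
        = (Kl / (Kl + 1)) * (1 / (Kk + 1)) *
            (∑ i, ∑ j, star (hbl i) * Rk i j * hbl j).re
          + ((Rl * Rk).trace).re / ((Kk + 1) * (Kl + 1))
          + (Kk / (Kk + 1)) * (1 / (Kl + 1)) *
              (∑ i, ∑ j, star (hbk i) * Rl i j * hbk j).re) := by
  obtain ⟨huint, hu2int, humean, hu2⟩ :=
    ricean_moments hKk hbk hSk.isHermitian hSk2 hzkint1 hzkint2 hzkmean hzkcov
  obtain ⟨hvint, hv2int, hvmean, hv2⟩ :=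
    ricean_moments hKl hbl hSl.isHermitian hSl2 hzlint1 hzlint2 hzlmean hzlcov
  have hind : IndepFun (fun ω => ricean Kk hbk Sk (zk ω)) (fun ω => ricean Kl hbl Sl (zl ω)) P :=
    hindep.comp (measurable_ricean Kk hbk Sk) (measurable_ricean Kl hbl Sl)
  obtain ⟨hT, hTmean⟩ := hasMean_star_dotProduct hind huint hvint
  obtain ⟨hT2, hTsq⟩ := secondMoment_star_dotProduct hind hu2int hv2int
  simp only [humean, hvmean] at hTmean
  simp only [hu2, hv2] at hTsq
  constructor
  · rw [hTmean, Finset.mul_sum]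
    refine Finset.sum_congr rfl fun i _ => ?_
    have hstar : star (Real.sqrt (Kk / (Kk + 1)) : ℂ) = Real.sqrt (Kk / (Kk + 1)) :=
      Complex.conj_ofReal _
    rw [star_mul', hstar]
    push_cast
    ring
  · rw [integral_norm_sub_integral_sq hT hT2, hTsq, hTmean, sum_secondMoment_sub_normSq,
      sum_star_smul_mul_mul (by positivity), sum_star_smul_mul_mul (by positivity)]
    simp only [← Complex.ofReal_mul, Complex.add_re, Complex.re_ofReal_mul, ← mul_assoc]
    field_simp
end
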